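/- Let R be a commutative Noetherian ring, let A be a deformable R-algebra (a positively filtered R-algebra with exhaustive filtration F_•A, with F_0A an R-subalgebra, whose associated graded ring gr A is a flat R-module), and let r ∈ R be a regular element. Then the r-th deformation A_r := Σ_{i≥0} r^i F_iA, equipped with the subspace filtration F_iA_r := F_iA ∩ A_r, is again a deformable R-algebra; moreover F_iA_r = Σ_{j=0}^{i} r^j F_jA for every i, and for every i ≥ 1 the R-linear map F_iA/F_{i−1}A → F_iA_r/F_{i−1}A_r induced by x ↦ r^i x is a well-defined bijection, so that gr A ≅ gr A_r as graded R-modules. -/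

import Mathlib

open Pointwise DirectSum

section

variable {R A : Type*} [CommRing R] [Ring A] [Algebra R A]

/-- The shift `i ↦ F_{i-1}` of a filtration, with the convention `F_{-1} = 0`. -/
def prevFiltration (F : ℕ → Submodule R A) : ℕ → Submodule R A
  | 0 => ⊥
  | (i + 1) => F i

/-- The `i`-th graded piece `F_iA/F_{i-1}A` of a filtration `F` (with `F_{-1}A = 0`). -/
def grPiece (F : ℕ → Submodule R A) (i : ℕ) :=
  ↥(F i) ⧸ Submodule.comap (F i).subtype (prevFiltration F i)

noncomputable instance (F : ℕ → Submodule R A) (i : ℕ) : AddCommGroup (grPiece F i) :=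
  inferInstanceAs
    (AddCommGroup (↥(F i) ⧸ Submodule.comap (F i).subtype (prevFiltration F i)))

noncomputable instance (F : ℕ → Submodule R A) (i : ℕ) : Module R (grPiece F i) :=
  inferInstanceAs
    (Module R (↥(F i) ⧸ Submodule.comap (F i).subtype (prevFiltration F i)))

/-- A filtration `F` on an `R`-subalgebra `S` of `A` (given as a submodule) makes `S` a
*deformable* `R`-algebra if it is increasing, `F_0` is an `R`-subalgebra,
`F_i · F_j ⊆ F_{i+j}`, the filtration is exhaustive (`⋃ᵢ F_i = S`, so in particular each
`F_i ⊆ S`), and the associated graded module `gr = ⊕ᵢ F_i/F_{i-1}` is a flat `R`-module.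
Taking `S = ⊤` recovers the notion of a deformable `R`-algebra structure on `A` itself. -/
structure IsDeformableFiltration (S : Submodule R A) (F : ℕ → Submodule R A) : Prop where
  mono : Monotone F
  one_mem : (1 : A) ∈ F 0
  mul_mem : ∀ i j : ℕ, ∀ x ∈ F i, ∀ y ∈ F j, x * y ∈ F (i + j)
  exhaustive : (⨆ i, F i) = S
  flat : Module.Flat R (⨁ i, grPiece F i)

end

section helpers

variable {R A : Type*} [CommRing R] [Ring A] [Algebra R A]

theorem aux_flat_piece {S : Submodule R A} {F : ℕ → Submodule R A}
    (hF : IsDeformableFiltration S F) (i : ℕ) : Module.Flat R (grPiece F i) := by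
  classical
  have := hF.flat
  exact Module.Flat.directSum_iff.mp this i

theorem aux_prev {S : Submodule R A} {F : ℕ → Submodule R A}
    (hF : IsDeformableFiltration S F) {r : R} (hr : r ∈ nonZeroDivisors R) (i : ℕ) (k : ℕ)
    (x : A) (hx : x ∈ F i) (h : r ^ k • x ∈ prevFiltration F i) : x ∈ prevFiltration F i := by
  have := aux_flat_piece hF i
  have hreg : IsSMulRegular (grPiece F i) (r ^ k) :=
    Module.Flat.isSMulRegular_of_nonZeroDivisors (pow_mem hr k)
  have h0 : r ^ k • (Submodule.Quotient.mk ⟨x, hx⟩ : grPiece F i) = 0 := by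
    refine ((Submodule.Quotient.mk_eq_zero
      (Submodule.comap (F i).subtype (prevFiltration F i))
      (x := r ^ k • (⟨x, hx⟩ : F i))).2 ?_)
    exact h
  have h1 : (Submodule.Quotient.mk ⟨x, hx⟩ : grPiece F i) = 0 :=
    hreg (h0.trans (smul_zero _).symm)
  exact (Submodule.Quotient.mk_eq_zero
      (Submodule.comap (F i).subtype (prevFiltration F i))).1 h1

theorem aux_smul_le {F : ℕ → Submodule R A} (hm : Monotone F) (r : R) (i : ℕ) :
    (⨆ j ∈ Finset.range (i + 1), r ^ j • F j) ≤ F i := by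
  refine iSup₂_le fun j hj => ?_
  intro y hy
  obtain ⟨x, hx, rfl⟩ := (Submodule.mem_smul_pointwise_iff_exists _ _ _).1 hy
  exact Submodule.smul_mem _ _ (hm (Nat.lt_succ_iff.1 (Finset.mem_range.1 hj)) hx)

theorem aux_mono (F : ℕ → Submodule R A) (r : R) :
    Monotone (fun i => ⨆ j ∈ Finset.range (i + 1), r ^ j • F j) := by
  intro a b hab
  exact biSup_mono fun j hj => by
    simp only [Finset.mem_range] at *
    omega

theorem aux_succ (F : ℕ → Submodule R A) (r : R) (i : ℕ) :
    (⨆ j ∈ Finset.range (i + 1), r ^ j • F j) =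
      r ^ i • F i ⊔ ⨆ j ∈ Finset.range i, r ^ j • F j := by
  rw [Finset.range_add_one, Finset.iSup_insert]

theorem aux_inter {S : Submodule R A} {F : ℕ → Submodule R A}
    (hF : IsDeformableFiltration S F) {r : R} (hr : r ∈ nonZeroDivisors R) (i n : ℕ) :
    ∀ y ∈ F i, y ∈ (⨆ j ∈ Finset.range (n + 1), r ^ j • F j) →
      y ∈ (⨆ j ∈ Finset.range (i + 1), r ^ j • F j) := by
  induction n with
  | zero => exact fun y _ h => aux_mono F r (Nat.zero_le i) h
  | succ n ih =>
    intro y hy h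
    by_cases hni : n + 1 ≤ i
    · exact aux_mono F r hni h
    · refine ih y hy ?_
      rw [aux_succ] at h
      obtain ⟨z, hz, g, hg, rfl⟩ := Submodule.mem_sup.1 h
      obtain ⟨x, hx, rfl⟩ := (Submodule.mem_smul_pointwise_iff_exists _ _ _).1 hz
      refine Submodule.add_mem _ ?_ hg
      have h1 : r ^ (n + 1) • x ∈ F n := by
        have := Submodule.sub_mem _ (hF.mono (by omega : i ≤ n) hy) (aux_smul_le hF.mono r n hg)
        simpa using this
      have h2 : x ∈ F n := aux_prev hF hr (n + 1) (n + 1) x hx h1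
      rw [pow_succ, mul_smul]
      exact (le_biSup (fun j => r ^ j • F j) (Finset.self_mem_range_succ n))
        (Submodule.smul_mem_pointwise_smul _ _ _ (Submodule.smul_mem _ r h2))

theorem aux_eq {S : Submodule R A} {F : ℕ → Submodule R A}
    (hF : IsDeformableFiltration S F) {r : R} (hr : r ∈ nonZeroDivisors R) (i : ℕ) :
    F i ⊓ (⨆ j, r ^ j • F j) = ⨆ j ∈ Finset.range (i + 1), r ^ j • F j := by
  apply le_antisymm
  · rintro y ⟨hy, h⟩
    have hle : (⨆ j, r ^ j • F j) ≤ ⨆ n, ⨆ j ∈ Finset.range (n + 1), r ^ j • F j :=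
      iSup_le fun j => le_trans
        (le_biSup (fun j => r ^ j • F j) (Finset.self_mem_range_succ j))
        (le_iSup (fun n => ⨆ j ∈ Finset.range (n + 1), r ^ j • F j) j)
    obtain ⟨n, hn⟩ := (Submodule.mem_iSup_of_directed _ (aux_mono F r).directed_le).1 (hle h)
    exact aux_inter hF hr i n y hy hn
  · exact le_inf (aux_smul_le hF.mono r i) (iSup₂_le fun j _ => le_iSup (fun j => r ^ j • F j) j)

theorem aux_smul_mem (F : ℕ → Submodule R A) (r : R) (i : ℕ) (x : A) (hx : x ∈ F i) :
    r ^ i • x ∈ F i ⊓ (⨆ j, r ^ j • F j) :=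
  ⟨Submodule.smul_mem _ _ hx, le_iSup (fun j => r ^ j • F j) i
    (Submodule.smul_mem_pointwise_smul _ _ _ hx)⟩

/-- multiplication by `r ^ i` into the graded piece -/
noncomputable def auxMap (F : ℕ → Submodule R A) (r : R) (i : ℕ) :
    F i →ₗ[R] (↥(F i ⊓ ⨆ j, r ^ j • F j) ⧸
      Submodule.comap (F i ⊓ ⨆ j, r ^ j • F j).subtype
        (prevFiltration (fun i => F i ⊓ ⨆ j, r ^ j • F j) i)) :=
  (Submodule.mkQ _).comp
    (LinearMap.codRestrict _ (r ^ i • (F i).subtype) fun x => aux_smul_mem F r i x x.2)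

theorem auxMap_ker {S : Submodule R A} {F : ℕ → Submodule R A}
    (hF : IsDeformableFiltration S F) {r : R} (hr : r ∈ nonZeroDivisors R) (i : ℕ) :
    Submodule.comap (F i).subtype (prevFiltration F i) = LinearMap.ker (auxMap F r i) := by
  ext x
  have h1 : x ∈ LinearMap.ker (auxMap F r i) ↔
      r ^ i • (x : A) ∈ prevFiltration (fun i => F i ⊓ ⨆ j, r ^ j • F j) i := by
    rw [LinearMap.mem_ker]
    exact Submodule.Quotient.mk_eq_zero _
  rw [h1, Submodule.mem_comap]
  constructor
  · intro h
    cases i with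
    | zero => exact Submodule.smul_mem _ _ h
    | succ n =>
      have h' : (x : A) ∈ F n := h
      have := aux_smul_mem F r n (r • (x : A)) (Submodule.smul_mem _ _ h')
      rw [← mul_smul, ← pow_succ] at this
      exact this
  · intro h
    refine aux_prev hF hr i i x x.2 ?_
    cases i with
    | zero => exact h
    | succ n => exact h.1

theorem auxMap_surj {S : Submodule R A} {F : ℕ → Submodule R A}
    (hF : IsDeformableFiltration S F) {r : R} (hr : r ∈ nonZeroDivisors R) (i : ℕ) :
    Function.Surjective (auxMap F r i) := by
  intro q
  obtain ⟨⟨y, hy⟩, rfl⟩ := Submodule.Quotient.mk_surjective _ q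
  have hy' := hy
  rw [aux_eq hF hr, aux_succ] at hy'
  obtain ⟨z, hz, g, hg, rfl⟩ := Submodule.mem_sup.1 hy'
  obtain ⟨x, hx, rfl⟩ := (Submodule.mem_smul_pointwise_iff_exists _ _ _).1 hz
  refine ⟨⟨x, hx⟩, ?_⟩
  refine (Submodule.Quotient.eq _).2 ?_
  change r ^ i • x - (r ^ i • x + g) ∈ prevFiltration (fun i => F i ⊓ ⨆ j, r ^ j • F j) i
  rw [sub_add_cancel_left]
  refine Submodule.neg_mem _ ?_
  cases i with
  | zero => simpa [prevFiltration] using hg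
  | succ n =>
    rw [← aux_eq hF hr] at hg
    exact hg

/-- the graded isomorphism -/
noncomputable def auxEquiv {S : Submodule R A} {F : ℕ → Submodule R A}
    (hF : IsDeformableFiltration S F) {r : R} (hr : r ∈ nonZeroDivisors R) (i : ℕ) :
    grPiece F i ≃ₗ[R] grPiece (fun i => F i ⊓ ⨆ j, r ^ j • F j) i :=
  (Submodule.quotEquivOfEq _ _ (auxMap_ker hF hr i)).trans
    ((auxMap F r i).quotKerEquivOfSurjective (auxMap_surj hF hr i))

theorem auxEquiv_mk {S : Submodule R A} {F : ℕ → Submodule R A}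
    (hF : IsDeformableFiltration S F) {r : R} (hr : r ∈ nonZeroDivisors R) (i : ℕ)
    (x : ↥(F i)) (y : ↥(F i ⊓ ⨆ j, r ^ j • F j)) (h : (y : A) = r ^ i • (x : A)) :
    auxEquiv hF hr i (Submodule.Quotient.mk x) = Submodule.Quotient.mk y := by
  have : y = ⟨r ^ i • (x : A), aux_smul_mem F r i x x.2⟩ := Subtype.ext h
  subst this
  rfl

theorem aux_mul {S : Submodule R A} {F : ℕ → Submodule R A}
    (hF : IsDeformableFiltration S F) (r : R) :
    (⨆ j, r ^ j • F j) * (⨆ j, r ^ j • F j) ≤ ⨆ j, r ^ j • F j := by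
  rw [Submodule.iSup_mul]
  refine iSup_le fun i => ?_
  rw [Submodule.mul_iSup]
  refine iSup_le fun j => ?_
  rw [Submodule.mul_le]
  intro a ha b hb
  obtain ⟨x, hx, rfl⟩ := (Submodule.mem_smul_pointwise_iff_exists _ _ _).1 ha
  obtain ⟨y, hy, rfl⟩ := (Submodule.mem_smul_pointwise_iff_exists _ _ _).1 hb
  rw [smul_mul_smul_comm, ← pow_add]
  exact (aux_smul_mem F r (i + j) _ (hF.mul_mem i j x hx y hy)).2

end helpers

/-- **The `r`-th deformation of a deformable algebra is deformable.**
Let `R` be a commutative Noetherian ring, `A` a deformable `R`-algebra with filtration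
`F_•A`, and `r ∈ R` a regular element.  Then the `r`-th deformation
`A_r = Σ_{i≥0} rᶦ·F_iA`, with the subspace filtration `F_iA_r = F_iA ∩ A_r`, is again a
deformable `R`-algebra; moreover `F_iA_r = Σ_{j=0}^{i} rʲ·F_jA` for every `i`, and for
every `i ≥ 1` the `R`-linear map `F_iA/F_{i-1}A → F_iA_r/F_{i-1}A_r` induced by
`x ↦ rᶦ·x` is a well-defined bijection, so that `gr A ≅ gr A_r` as graded `R`-modules. -/
theorem isDeformableFiltration_deformation
    {R A : Type*} [CommRing R] [IsNoetherianRing R] [Ring A] [Algebra R A]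
    (F : ℕ → Submodule R A) (hF : IsDeformableFiltration (⊤ : Submodule R A) F)
    (r : R) (hr : r ∈ nonZeroDivisors R) :
    IsDeformableFiltration (⨆ i, r ^ i • F i) (fun i => F i ⊓ ⨆ j, r ^ j • F j) ∧
    (∀ i : ℕ, F i ⊓ (⨆ j, r ^ j • F j) = ⨆ j ∈ Finset.range (i + 1), r ^ j • F j) ∧
    (∀ i : ℕ, 1 ≤ i →
      ∃ e : grPiece F i ≃ₗ[R] grPiece (fun i => F i ⊓ ⨆ j, r ^ j • F j) i,
        ∀ (x : ↥(F i)) (y : ↥(F i ⊓ ⨆ j, r ^ j • F j)),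
          (y : A) = r ^ i • (x : A) →
            e (Submodule.Quotient.mk x) = Submodule.Quotient.mk y) ∧
    (∀ i : ℕ, Nonempty
      (grPiece F i ≃ₗ[R] grPiece (fun i => F i ⊓ ⨆ j, r ^ j • F j) i)) := by
  refine ⟨⟨?_, ?_, ?_, ?_, ?_⟩, aux_eq hF hr, fun i _ => ⟨auxEquiv hF hr i, auxEquiv_mk hF hr i⟩,
    fun i => ⟨auxEquiv hF hr i⟩⟩
  · exact fun a b hab => inf_le_inf_right _ (hF.mono hab)
  · simpa using aux_smul_mem F r 0 1 hF.one_mem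
  · exact fun i j x hx y hy => ⟨hF.mul_mem i j x hx.1 y hy.1,
      aux_mul hF r (Submodule.mul_mem_mul hx.2 hy.2)⟩
  · refine le_antisymm (iSup_le fun i => inf_le_right) (iSup_le fun i => ?_)
    refine le_trans ?_ (le_iSup (fun i => F i ⊓ ⨆ j, r ^ j • F j) i)
    intro y hy
    obtain ⟨x, hx, rfl⟩ := (Submodule.mem_smul_pointwise_iff_exists _ _ _).1 hy
    exact aux_smul_mem F r i x hx
  · classical
    refine Module.Flat.directSum_iff.mpr fun i => ?_
    have := aux_flat_piece hF i
    exact Module.Flat.of_linearEquiv (auxEquiv hF hr i).symm
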